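/- arXiv:1907.06456 — 2 statements merged into one kernel-verified Lean document; each statement's English description precedes it below -/
import Mathlib

section
/- Let q = p^e be a prime power and R a reduced noetherian commutative ring containing 𝔽_q whose prime spectrum Spec R is connected. Suppose g ∈ GL₂(R((z))) satisfies: (i) all entries of g⁻¹·diag(z,1)·σ(g) lie in R[[z]]; and (ii) det(g⁻¹·diag(z,1)·σ(g)) = z·u for some unit u of R[[z]]. Then there exist integers m, n such that diag(z^{-m}, z^{-n})·g ∈ GL₂(R[[z]]). -/
namespace LaurentSeries

variable {A : Type*} [CommRing A]

lemma mk_coeff_mul_add {I : Ideal A} {x y : LaurentSeries A} {a b : ℤ}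
    (hx : ∀ k < a, x.coeff k ∈ I) (hy : ∀ k < b, y.coeff k ∈ I) :
    Ideal.Quotient.mk I ((x * y).coeff (a + b)) =
      Ideal.Quotient.mk I (x.coeff a) * Ideal.Quotient.mk I (y.coeff b) := by
  rw [HahnSeries.coeff_mul, map_sum, Finset.sum_eq_single (a, b), map_mul]
  · rintro ⟨i, j⟩ hij hne
    have hsum : i + j = a + b := (Finset.mem_antidiagonal.1 hij).2.2
    rw [Ideal.Quotient.eq_zero_iff_mem]
    rcases lt_trichotomy i a with h | h | h
    · exact I.mul_mem_right _ (hx i h)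
    · exact absurd (Prod.ext h (by dsimp only; lia)) hne
    · exact I.mul_mem_left _ (hy j (by lia))
  · intro hab
    by_cases hxa : x.coeff a = 0
    · simp [hxa]
    by_cases hyb : y.coeff b = 0
    · simp [hyb]
    exact absurd (Finset.mem_antidiagonal.2 ⟨hxa, hyb, rfl⟩) hab

lemma coeff_mul_mem_of_lt {I : Ideal A} {x y : LaurentSeries A} {a b k : ℤ}
    (hx : ∀ k < a, x.coeff k ∈ I) (hy : ∀ k < b, y.coeff k ∈ I) (hk : k < a + b) :
    (x * y).coeff k ∈ I := by
  have h := mk_coeff_mul_add (a := k - b) (fun i hi => hx i (by lia)) hy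
  rw [sub_add_cancel, Ideal.Quotient.eq_zero_iff_mem.2 (hx (k - b) (by lia)), zero_mul] at h
  exact Ideal.Quotient.eq_zero_iff_mem.1 h

lemma coeff_mul_mem {I : Ideal A} {x : LaurentSeries A} (hx : ∀ k, x.coeff k ∈ I)
    (y : LaurentSeries A) (k : ℤ) : (x * y).coeff k ∈ I := by
  rw [HahnSeries.coeff_mul]
  exact I.sum_mem fun i _ => I.mul_mem_right _ (hx i.1)

/-- `n` is the least order modulo `P` among the members of the family `f`. -/
def IsOrderAt {ι : Type*} (P : Ideal A) (f : ι → LaurentSeries A) (n : ℤ) : Prop :=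
  (∀ j, ∀ k < n, (f j).coeff k ∈ P) ∧ ∃ j, (f j).coeff n ∉ P

lemma exists_isOrderAt {ι : Type*} [Finite ι] {P : Ideal A} {f : ι → LaurentSeries A}
    (hf : ¬ ∀ j k, (f j).coeff k ∈ P) : ∃ n, IsOrderAt P f n := by
  push Not at hf
  obtain ⟨j, k, hjk⟩ := hf
  obtain ⟨N, hN⟩ := (Set.finite_range fun j => (f j).order).bddBelow
  obtain ⟨n, hn, hmin⟩ := Int.exists_least_of_bdd (P := fun k => ∃ j, (f j).coeff k ∉ P)
    ⟨N, by
      rintro k ⟨j, hj⟩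
      by_contra! hk
      refine hj ?_
      rw [HahnSeries.coeff_eq_zero_of_lt_order (hk.trans_le (hN ⟨j, rfl⟩))]
      exact P.zero_mem⟩ ⟨k, j, hjk⟩
  refine ⟨n, fun j k hk => ?_, hn⟩
  by_contra h
  exact absurd (hmin k ⟨j, h⟩) (not_le.2 hk)

lemma IsOrderAt.le_iff {ι : Type*} {P : Ideal A} {f : ι → LaurentSeries A} {n : ℤ}
    (h : IsOrderAt P f n) (a : ℤ) : a ≤ n ↔ ∀ j, ∀ k < a, (f j).coeff k ∈ P := by
  refine ⟨fun ha j k hk => h.1 j k (hk.trans_le ha), fun H => ?_⟩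
  by_contra! hn
  obtain ⟨j, hj⟩ := h.2
  exact hj (H j n hn)

lemma isClosed_le_of_isOrderAt {ι : Type*} {f : ι → LaurentSeries A}
    {n : PrimeSpectrum A → ℤ} (h : ∀ P, IsOrderAt P.asIdeal f (n P)) (a : ℤ) :
    IsClosed {P | a ≤ n P} := by
  have heq : {P | a ≤ n P} =
      PrimeSpectrum.zeroLocus {c | ∃ j, ∃ k < a, (f j).coeff k = c} := by
    ext P
    rw [Set.mem_ofPred_eq, (h P).le_iff, PrimeSpectrum.mem_zeroLocus]
    constructor
    · rintro H _ ⟨j, k, hk, rfl⟩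
      exact H j k hk
    · exact fun H j k hk => H ⟨j, k, hk, rfl⟩
  rw [heq]
  exact PrimeSpectrum.isClosed_zeroLocus _

lemma exists_ofPowerSeries_eq {f : LaurentSeries A} (hf : ∀ k < 0, f.coeff k = 0) :
    ∃ F : PowerSeries A, HahnSeries.ofPowerSeries ℤ A F = f ∧
      PowerSeries.constantCoeff F = f.coeff 0 := by
  refine ⟨PowerSeries.mk fun n => f.coeff n, ?_, ?_⟩
  · ext k
    rw [PowerSeries.coeff_coe]
    split_ifs with hk
    · exact (hf k hk).symm
    · rw [PowerSeries.coeff_mk, Int.natAbs_of_nonneg (not_lt.1 hk)]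
  · rw [← PowerSeries.coeff_zero_eq_constantCoeff_apply, PowerSeries.coeff_mk, Nat.cast_zero]

lemma isOrderAt_det {P : Ideal A} {g : Matrix (Fin 2) (Fin 2) (LaurentSeries A)} {m n : ℤ}
    (hm : IsOrderAt P (g 0) m) (hn : IsOrderAt P (g 1) n)
    (h : (g 0 0).coeff m * (g 1 1).coeff n - (g 0 1).coeff m * (g 1 0).coeff n ∉ P) :
    IsOrderAt P (fun _ : Unit => g.det) (m + n) := by
  refine ⟨fun _ k hk => ?_, (), fun H => h ?_⟩
  · rw [Matrix.det_fin_two, HahnSeries.coeff_sub]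
    exact P.sub_mem (coeff_mul_mem_of_lt (hm.1 0) (hn.1 1) hk)
      (coeff_mul_mem_of_lt (hm.1 1) (hn.1 0) hk)
  · rw [Matrix.det_fin_two, HahnSeries.coeff_sub, ← Ideal.Quotient.eq_zero_iff_mem, map_sub,
      mk_coeff_mul_add (hm.1 0) (hn.1 1), mk_coeff_mul_add (hm.1 1) (hn.1 0)] at H
    rwa [← Ideal.Quotient.eq_zero_iff_mem, map_sub, map_mul, map_mul]

lemma IsOrderAt.add_eq_zero {P : Ideal A} (hP : P.IsPrime) {x y : LaurentSeries A} {a b : ℤ}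
    (hx : IsOrderAt P (fun _ : Unit => x) a) (hy : IsOrderAt P (fun _ : Unit => y) b)
    (hxy : x * y = 1) : a + b = 0 := by
  by_contra hab
  obtain ⟨_, hxa⟩ := hx.2
  obtain ⟨_, hyb⟩ := hy.2
  have h := mk_coeff_mul_add (hx.1 ()) (hy.1 ())
  rw [hxy, HahnSeries.coeff_one, if_neg hab, map_zero, ← map_mul, eq_comm,
    Ideal.Quotient.eq_zero_iff_mem] at h
  exact (hP.mem_or_mem h).elim hxa hyb

/-- Modulo a prime, the leading coefficient vectors of the two rows of `g` are independent: the
constant term of `τ` kills the first one and maps the second one to its Frobenius twist. -/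
lemma leading_det_notMem {P : Ideal A} (hP : P.IsPrime) {q : ℕ} (hq : q ≠ 0)
    {σ : LaurentSeries A →+* LaurentSeries A}
    (hσ : ∀ (f : LaurentSeries A) (n : ℤ), (σ f).coeff n = f.coeff n ^ q)
    {g τ : Matrix (Fin 2) (Fin 2) (LaurentSeries A)}
    (hgτ : g * τ = Matrix.diagonal ![HahnSeries.single (1 : ℤ) (1 : A), 1] * g.map σ)
    (hint : ∀ (i j : Fin 2) (n : ℤ), n < 0 → (τ i j).coeff n = 0) {m n : ℤ}
    (hm : IsOrderAt P (g 0) m) (hn : IsOrderAt P (g 1) n) :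
    (g 0 0).coeff m * (g 1 1).coeff n - (g 0 1).coeff m * (g 1 0).coeff n ∉ P := by
  intro hdet
  have hτ : ∀ i j, ∀ k < 0, (τ i j).coeff k ∈ P := fun i j k hk => by
    rw [hint i j k hk]; exact P.zero_mem
  set π := Ideal.Quotient.mk P with hπ
  have row : ∀ (i j : Fin 2) (r : ℤ), IsOrderAt P (g i) r →
      π (((g * τ) i j).coeff r) = π ((g i 0).coeff r) * π ((τ 0 j).coeff 0) +
        π ((g i 1).coeff r) * π ((τ 1 j).coeff 0) := by
    intro i j r hr
    have h0 := mk_coeff_mul_add (hr.1 0) (hτ 0 j)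
    have h1 := mk_coeff_mul_add (hr.1 1) (hτ 1 j)
    rw [add_zero] at h0 h1
    rw [Matrix.mul_apply, Fin.sum_univ_two, HahnSeries.coeff_add, map_add, h0, h1]
  have row0 : ∀ j, π ((g 0 0).coeff m) * π ((τ 0 j).coeff 0) +
      π ((g 0 1).coeff m) * π ((τ 1 j).coeff 0) = 0 := by
    intro j
    rw [← row 0 j m hm, hgτ, Matrix.diagonal_mul, Ideal.Quotient.eq_zero_iff_mem]
    simp only [Matrix.cons_val_zero, Matrix.map_apply, HahnSeries.coeff_single_mul, hσ, one_mul]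
    exact P.pow_mem_of_mem (hm.1 j _ (by lia)) q (Nat.pos_of_ne_zero hq)
  have row1 : ∀ j, π ((g 1 0).coeff n) * π ((τ 0 j).coeff 0) +
      π ((g 1 1).coeff n) * π ((τ 1 j).coeff 0) = π ((g 1 j).coeff n) ^ q := by
    intro j
    rw [← row 1 j n hn, hgτ, Matrix.diagonal_mul]
    simp [hσ]
  rw [← Ideal.Quotient.eq_zero_iff_mem, ← hπ, map_sub, map_mul, map_mul] at hdet
  obtain ⟨j, hj⟩ := hn.2
  obtain ⟨i, hi⟩ := hm.2
  rw [← Ideal.Quotient.eq_zero_iff_mem, ← hπ] at hi hj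
  have hzero : ∀ i, π ((g 0 i).coeff m) * π ((g 1 j).coeff n) ^ q = 0 := by
    rw [← row1 j, Fin.forall_fin_two]
    have h := row0 j
    constructor
    · linear_combination π ((g 1 0).coeff n) * h + π ((τ 1 j).coeff 0) * hdet
    · linear_combination π ((g 1 1).coeff n) * h - π ((τ 0 j).coeff 0) * hdet
  have := Ideal.Quotient.isDomain P
  exact mul_ne_zero hi (pow_ne_zero q hj) (hzero i)

end LaurentSeries

lemma exists_eq_const_of_isClosed_le {X : Type*} [TopologicalSpace X] [ConnectedSpace X]
    {f g : X → ℤ} (hf : ∀ a, IsClosed {x | a ≤ f x}) (hg : ∀ a, IsClosed {x | a ≤ g x})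
    {c : ℤ} (hfg : ∀ x, f x + g x = c) : ∃ a, ∀ x, f x = a := by
  obtain ⟨x₀⟩ := (inferInstance : Nonempty X)
  have hclopen : ∀ a, IsClopen {x | a ≤ f x} := by
    refine fun a => ⟨hf a, ?_⟩
    have h : {x | a ≤ f x} = {x | c - a + 1 ≤ g x}ᶜ := by
      ext x
      have := hfg x
      simp only [Set.mem_ofPred_eq, Set.mem_compl_iff]
      lia
    rw [h]
    exact (hg _).isOpen_compl
  have hmem : ∀ a x y, a ≤ f x → a ≤ f y := by
    intro a x y hx
    have huniv : {x | a ≤ f x} = Set.univ := (hclopen a).eq_univ ⟨x, hx⟩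
    exact Set.eq_univ_iff_forall.1 huniv y
  exact ⟨f x₀, fun x => le_antisymm (hmem _ x x₀ le_rfl) (hmem _ x₀ x le_rfl)⟩

lemma eq_zero_of_forall_mem_prime {A : Type*} [CommRing A] [IsReduced A] {a : A}
    (h : ∀ P : PrimeSpectrum A, a ∈ P.asIdeal) : a = 0 :=
  (nilpotent_iff_mem_prime.2 fun J hJ => h ⟨J, hJ⟩).eq_zero

lemma isUnit_of_forall_notMem_prime {A : Type*} [CommRing A] {a : A}
    (h : ∀ P : PrimeSpectrum A, a ∉ P.asIdeal) : IsUnit a := by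
  by_contra ha
  obtain ⟨M, hM, haM⟩ := exists_max_ideal_of_mem_nonunits ha
  exact h ⟨M, hM.isPrime⟩ haM

open LaurentSeries in

/-- For `q = p^e` a prime power and `A` a reduced noetherian commutative ring
containing `𝔽_q` with connected prime spectrum, if `g ∈ GL₂(A((z)))` is such that
`g⁻¹·diag(z,1)·σ(g)` has all entries in `A[[z]]` and determinant `z·u` with `u ∈ A[[z]]ˣ`,
then there are integers `m, n` with `diag(z^{-m}, z^{-n})·g ∈ GL₂(A[[z]])`. -/
theorem stmt_3 {p e q : ℕ} [Fact p.Prime] (hq : q = p ^ e) (he : 0 < e)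
    {A : Type*} [CommRing A] [IsNoetherianRing A] [IsReduced A] [ConnectedSpace (PrimeSpectrum A)] [Algebra (GaloisField p e) A]
    (σ : LaurentSeries A →+* LaurentSeries A)
    (hσ : ∀ (f : LaurentSeries A) (n : ℤ), (σ f).coeff n = f.coeff n ^ q)
    (g : (Matrix (Fin 2) (Fin 2) (LaurentSeries A))ˣ)
    (τ : Matrix (Fin 2) (Fin 2) (LaurentSeries A))
    (hτ : τ = (↑g⁻¹ : Matrix (Fin 2) (Fin 2) (LaurentSeries A)) *
        Matrix.diagonal ![(HahnSeries.single (1 : ℤ) (1 : A) : LaurentSeries A), 1] *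
        ((↑g : Matrix (Fin 2) (Fin 2) (LaurentSeries A)).map ⇑σ))
    (hint : ∀ (i j : Fin 2) (n : ℤ), n < 0 → (τ i j).coeff n = 0)
    (hdet : ∃ u : (PowerSeries A)ˣ,
      τ.det = (HahnSeries.single (1 : ℤ) (1 : A) : LaurentSeries A) *
        HahnSeries.ofPowerSeries ℤ A ↑u) :
    ∃ m n : ℤ, ∃ G : (Matrix (Fin 2) (Fin 2) (PowerSeries A))ˣ,
      Matrix.diagonal ![(HahnSeries.single (-m) (1 : A) : LaurentSeries A),
          (HahnSeries.single (-n) (1 : A) : LaurentSeries A)] *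
          (↑g : Matrix (Fin 2) (Fin 2) (LaurentSeries A)) =
        (↑G : Matrix (Fin 2) (Fin 2) (PowerSeries A)).map ⇑(HahnSeries.ofPowerSeries ℤ A) := by
  have hq0 : q ≠ 0 := hq ▸ pow_ne_zero e (Fact.out : p.Prime).ne_zero
  set γ : Matrix (Fin 2) (Fin 2) (LaurentSeries A) := ↑g with hγ
  have hgτ : γ * τ = Matrix.diagonal ![HahnSeries.single (1 : ℤ) (1 : A), 1] * γ.map σ := by
    rw [hτ, ← Matrix.mul_assoc, ← Matrix.mul_assoc, hγ, Units.mul_inv, Matrix.one_mul]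
  set h : LaurentSeries A := (↑g⁻¹ : Matrix (Fin 2) (Fin 2) (LaurentSeries A)).det
  have hdh : γ.det * h = 1 := by rw [← Matrix.det_mul, hγ, Units.mul_inv, Matrix.det_one]
  have not_all_mem : ∀ (P : PrimeSpectrum A) (x y : LaurentSeries A), x * y = 1 →
      ¬ ∀ k, x.coeff k ∈ P.asIdeal := by
    intro P x y hxy hx
    have h1 := coeff_mul_mem hx y 0
    rw [hxy, HahnSeries.coeff_one, if_pos rfl] at h1
    exact P.isPrime.one_notMem h1
  have hrow : ∀ (i : Fin 2) (P : PrimeSpectrum A), ∃ r, IsOrderAt P.asIdeal (γ i) r := by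
    refine fun i P => exists_isOrderAt fun H => not_all_mem P _ _ hdh fun k => ?_
    rw [Matrix.det_fin_two, HahnSeries.coeff_sub]
    fin_cases i
    · exact sub_mem (coeff_mul_mem (H 0) _ k) (coeff_mul_mem (H 1) _ k)
    · rw [mul_comm (γ 0 0), mul_comm (γ 0 1)]
      exact sub_mem (coeff_mul_mem (H 1) _ k) (coeff_mul_mem (H 0) _ k)
  choose m hm using hrow 0
  choose n hn using hrow 1
  have hinv : ∀ P : PrimeSpectrum A, ∃ r, IsOrderAt P.asIdeal (fun _ : Unit => h) r :=
    fun P => exists_isOrderAt fun H => not_all_mem P h γ.det (by rw [mul_comm, hdh]) (H ())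
  choose o ho using hinv
  have hlead := fun P : PrimeSpectrum A =>
    leading_det_notMem P.isPrime hq0 hσ hgτ hint (hm P) (hn P)
  have hd := fun P => isOrderAt_det (hm P) (hn P) (hlead P)
  obtain ⟨c, hc⟩ := exists_eq_const_of_isClosed_le (isClosed_le_of_isOrderAt hd)
    (isClosed_le_of_isOrderAt ho) fun P => (hd P).add_eq_zero P.isPrime (ho P) hdh
  obtain ⟨M, hM⟩ := exists_eq_const_of_isClosed_le (isClosed_le_of_isOrderAt hm)
    (isClosed_le_of_isOrderAt hn) hc
  have hN : ∀ P, n P = c - M := fun P => by have := hc P; have := hM P; lia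
  set N := c - M
  have hcoeff : ∀ (i j : Fin 2), ∀ k < ![M, N] i, (γ i j).coeff k = 0 := by
    refine fun i j k hk => eq_zero_of_forall_mem_prime fun P => ?_
    fin_cases i
    · exact (hm P).1 j k (by simpa [hM] using hk)
    · exact (hn P).1 j k (by simpa [hN] using hk)
  have hlift : ∀ i j : Fin 2, ∃ F : PowerSeries A,
      HahnSeries.ofPowerSeries ℤ A F = HahnSeries.single (-![M, N] i) (1 : A) * γ i j ∧
        PowerSeries.constantCoeff F = (γ i j).coeff (![M, N] i) := by
    intro i j
    obtain ⟨F, hF, hF0⟩ := exists_ofPowerSeries_eq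
      (f := HahnSeries.single (-![M, N] i) (1 : A) * γ i j) fun k hk => by
        rw [HahnSeries.coeff_single_mul, one_mul]
        exact hcoeff i j _ (by lia)
    refine ⟨F, hF, ?_⟩
    rw [hF0, HahnSeries.coeff_single_mul, one_mul, zero_sub, neg_neg]
  choose G hG hG0 using hlift
  have hGu : IsUnit (Matrix.of G) := by
    rw [Matrix.isUnit_iff_isUnit_det, PowerSeries.isUnit_iff_constantCoeff, Matrix.det_fin_two]
    refine isUnit_of_forall_notMem_prime fun P => ?_
    have := hlead P
    rw [hM, hN] at this
    simpa [hG0] using this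
  refine ⟨M, N, hGu.unit, ?_⟩
  ext i j : 2
  rw [Matrix.diagonal_mul, IsUnit.unit_spec, Matrix.map_apply, Matrix.of_apply, hG]
  fin_cases i <;> rfl
end

section
/- Let q = p^e be a prime power, A a commutative ring containing 𝔽_q, ζ ∈ A nilpotent, h, h̃ ∈ A, and n ≥ 1 an integer. Then all entries of the matrix η_{n,h̃}⁻¹ · η_{n,h} lie in A[[z]] if and only if h = h̃. (Explicitly, η_{n,h̃}⁻¹ · η_{n,h} is lower triangular with diagonal entries 1 and lower-left entry ∑_{i=0}^{n-1} (h̃−h)^{q^i} · ∏_{j=0}^{i}(z−ζ^{q^j})⁻¹, and this Laurent series has all coefficients of negative powers of z equal to zero only when h = h̃.) -/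
/-- The quasi-isogeny matrix `η_{n,h}` over `A((z))`, with rows
`(∏_{i=0}^{n-1} z·(z−ζ^{q^i})⁻¹, 0)` and `(−∑_{i=0}^{n-1} h^{q^i}·∏_{j=0}^{i}(z−ζ^{q^j})⁻¹, 1)`. -/
noncomputable def eta (q : ℕ) {A : Type*} [CommRing A] (ζ h : A) (n : ℕ) :
    Matrix (Fin 2) (Fin 2) (LaurentSeries A) :=
  !![∏ i ∈ Finset.range n, (HahnSeries.single (1 : ℤ) (1 : A) : LaurentSeries A) *
        Ring.inverse ((HahnSeries.single (1 : ℤ) (1 : A) : LaurentSeries A) -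
          HahnSeries.C (ζ ^ q ^ i)), 0;
     -∑ i ∈ Finset.range n, HahnSeries.C (h ^ q ^ i) *
        ∏ j ∈ Finset.range (i + 1),
          Ring.inverse ((HahnSeries.single (1 : ℤ) (1 : A) : LaurentSeries A) -
            HahnSeries.C (ζ ^ q ^ j)), 1]

namespace HahnSeries

variable {A : Type*} [CommRing A]

/-- If `f` and `g` are supported in degrees at most `m` and `m'`, then `f * g` is supported in
degrees at most `m + m'`. -/
theorem coeff_mul_eq_zero_of_lt {f g : LaurentSeries A} {m m' : ℤ}
    (hf : ∀ k, m < k → f.coeff k = 0) (hg : ∀ k, m' < k → g.coeff k = 0) (k : ℤ)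
    (hk : m + m' < k) : (f * g).coeff k = 0 := by
  rw [coeff_mul]
  refine Finset.sum_eq_zero fun ij hij => ?_
  have hij := (Finset.mem_antidiagonal.1 hij).2.2
  by_cases h : m < ij.1
  · rw [hf _ h, zero_mul]
  · rw [hg _ (by lia), mul_zero]

theorem coeff_pow_eq_zero_of_pos {f : LaurentSeries A} (hf : ∀ k, 0 < k → f.coeff k = 0) (n : ℕ)
    (k : ℤ) (hk : 0 < k) : (f ^ n).coeff k = 0 := by
  induction n generalizing k with
  | zero => simp [coeff_one, hk.ne']
  | succ n ih =>
    rw [pow_succ]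
    exact coeff_mul_eq_zero_of_lt ih hf k (by simpa using hk)

/-- For nilpotent `a`, the Laurent series `z - a` is invertible, with inverse supported in negative
degrees. -/
theorem exists_single_sub_C_mul_eq_one {a : A} (ha : IsNilpotent a) :
    ∃ y : LaurentSeries A, ((single (1 : ℤ) (1 : A) : LaurentSeries A) - C a) * y = 1 ∧
      ∀ k, -1 < k → y.coeff k = 0 := by
  obtain ⟨N, hN⟩ := ha
  set w : LaurentSeries A := single (-1 : ℤ) (1 : A) with hw
  have hzw : (single (1 : ℤ) (1 : A) : LaurentSeries A) * w = 1 := by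
    simp [hw, single_mul_single]
  have hwc : ∀ k, -1 < k → w.coeff k = 0 := fun k hk => coeff_single_of_ne hk.ne'
  refine ⟨w * ∑ i ∈ Finset.range N, (C a * w) ^ i, ?_, ?_⟩
  · rw [← mul_assoc, sub_mul, hzw, mul_neg_geom_sum, mul_pow, ← map_pow, hN, map_zero, zero_mul,
      sub_zero]
  · intro k hk
    refine coeff_mul_eq_zero_of_lt (m' := 0) hwc (fun l hl => ?_) k (by simpa using hk)
    rw [coeff_sum]
    refine Finset.sum_eq_zero fun i _ => coeff_pow_eq_zero_of_pos (fun l hl => ?_) i l hl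
    rw [C_mul_eq_smul, coeff_smul, hwc l (by lia), smul_zero]

theorem isUnit_single_sub_C {a : A} (ha : IsNilpotent a) :
    IsUnit ((single (1 : ℤ) (1 : A) : LaurentSeries A) - C a) :=
  let ⟨_, hy, _⟩ := exists_single_sub_C_mul_eq_one ha
  .of_mul_eq_one _ hy

theorem coeff_inverse_single_sub_C_of_lt {a : A} (ha : IsNilpotent a) (k : ℤ) (hk : -1 < k) :
    (Ring.inverse ((single (1 : ℤ) (1 : A) : LaurentSeries A) - C a)).coeff k = 0 := by
  obtain ⟨y, hy, hyc⟩ := exists_single_sub_C_mul_eq_one ha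
  rw [← mul_one (Ring.inverse _), ← hy, Ring.inverse_mul_cancel_left _ _ (isUnit_single_sub_C ha)]
  exact hyc k hk

theorem coeff_neg_one_inverse_single_sub_C {a : A} (ha : IsNilpotent a) :
    (Ring.inverse ((single (1 : ℤ) (1 : A) : LaurentSeries A) - C a)).coeff (-1) = 1 := by
  have h := congrArg (coeff · 0) (Ring.mul_inverse_cancel _ (isUnit_single_sub_C ha))
  have hs := coeff_single_mul_add (r := (1 : A)) (b := (1 : ℤ)) (a := -1)
    (x := Ring.inverse ((single (1 : ℤ) (1 : A) : LaurentSeries A) - C a))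
  rw [neg_add_cancel, one_mul] at hs
  simpa only [sub_mul, coeff_sub, hs, C_mul_eq_smul, coeff_smul,
    coeff_inverse_single_sub_C_of_lt ha 0 (by lia), smul_zero, sub_zero, coeff_one, if_true] using h

theorem coeff_prod_inverse_single_sub_C_of_lt {a : ℕ → A} (ha : ∀ i, IsNilpotent (a i)) (n : ℕ)
    (k : ℤ) (hk : -n < k) :
    (∏ j ∈ Finset.range n,
      Ring.inverse ((single (1 : ℤ) (1 : A) : LaurentSeries A) - C (a j))).coeff k = 0 := by
  induction n generalizing k with
  | zero =>
    rw [Finset.prod_range_zero, coeff_one, if_neg]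
    simpa using hk.ne'
  | succ n ih =>
    rw [Finset.prod_range_succ]
    exact coeff_mul_eq_zero_of_lt ih (coeff_inverse_single_sub_C_of_lt (ha n)) k
      (by push_cast at hk; lia)

/-- The residue of `∑ i, c i * ∏_{j ≤ i} (z - a j)⁻¹` is `c 0`. -/
theorem coeff_neg_one_sum_C_mul_prod_inverse {a : ℕ → A} (ha : ∀ i, IsNilpotent (a i))
    (c : ℕ → A) {n : ℕ} (hn : 1 ≤ n) :
    (∑ i ∈ Finset.range n, C (c i) * ∏ j ∈ Finset.range (i + 1),
      Ring.inverse ((single (1 : ℤ) (1 : A) : LaurentSeries A) - C (a j))).coeff (-1) = c 0 := by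
  rw [coeff_sum, Finset.sum_eq_single_of_mem 0 (Finset.mem_range.2 hn)]
  · rw [zero_add, Finset.prod_range_one, C_mul_eq_smul, coeff_smul,
      coeff_neg_one_inverse_single_sub_C (ha 0), smul_eq_mul, mul_one]
  · intro i _ hi
    rw [C_mul_eq_smul, coeff_smul,
      coeff_prod_inverse_single_sub_C_of_lt ha (i + 1) _ (by push_cast; lia), smul_zero]

end HahnSeries

theorem sub_pow_pow_of_algebra_galoisField {p e : ℕ} [Fact p.Prime] {A : Type*} [CommRing A]
    [Algebra (GaloisField p e) A] (x y : A) (i : ℕ) :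
    (x - y) ^ (p ^ e) ^ i = x ^ (p ^ e) ^ i - y ^ (p ^ e) ^ i := by
  cases subsingleton_or_nontrivial A
  · exact Subsingleton.elim _ _
  · have : CharP A p :=
      charP_of_injective_algebraMap (algebraMap (GaloisField p e) A).injective p
    rw [← pow_mul, sub_pow_char_pow]

theorem isUnit_eta (q : ℕ) {A : Type*} [CommRing A] {ζ : A} (hζ : ∀ i, IsNilpotent (ζ ^ q ^ i))
    (h : A) (n : ℕ) : IsUnit (eta q ζ h n) := by
  rw [Matrix.isUnit_iff_isUnit_det, eta, Matrix.det_fin_two_of, mul_one, zero_mul, sub_zero]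
  refine (IsUnit.prod_iff).2 fun i _ => .mul ?_ (HahnSeries.isUnit_single_sub_C (hζ i)).ringInverse
  simpa using HahnSeries.isUnit_single_sub_C (IsNilpotent.zero (R := A))

/-- For `q = p^e` a prime power, `A` a commutative ring containing `𝔽_q`,
`ζ ∈ A` nilpotent, `h, h' ∈ A` and `n ≥ 1`: `η_{n,h'}⁻¹ · η_{n,h}` is lower triangular with
diagonal entries `1` and lower-left entry `∑_{i=0}^{n-1} (h'−h)^{q^i}·∏_{j=0}^{i}(z−ζ^{q^j})⁻¹`,
and all its entries lie in `A[[z]]` if and only if `h = h'`. -/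
theorem stmt_6 {p e q : ℕ} [Fact p.Prime] (hq : q = p ^ e) (he : 0 < e)
    {A : Type*} [CommRing A] [Algebra (GaloisField p e) A]
    (ζ : A) (hζ : IsNilpotent ζ) (h h' : A) (n : ℕ) (hn : 1 ≤ n) :
    Ring.inverse (eta q ζ h' n) * eta q ζ h n =
      !![1, 0;
        ∑ i ∈ Finset.range n, HahnSeries.C ((h' - h) ^ q ^ i) *
          ∏ j ∈ Finset.range (i + 1),
            Ring.inverse ((HahnSeries.single (1 : ℤ) (1 : A) : LaurentSeries A) -
              HahnSeries.C (ζ ^ q ^ j)), 1] ∧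
    ((∀ (i j : Fin 2) (k : ℤ), k < 0 →
        ((Ring.inverse (eta q ζ h' n) * eta q ζ h n) i j).coeff k = 0) ↔ h = h') := by
  subst hq
  have hζ' : ∀ i, IsNilpotent (ζ ^ (p ^ e) ^ i) := fun i =>
    hζ.pow_of_pos (pow_ne_zero _ (pow_ne_zero _ (Fact.out : p.Prime).ne_zero))
  have key : Ring.inverse (eta (p ^ e) ζ h' n) * eta (p ^ e) ζ h n =
      !![1, 0;
        ∑ i ∈ Finset.range n, HahnSeries.C ((h' - h) ^ (p ^ e) ^ i) *
          ∏ j ∈ Finset.range (i + 1),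
            Ring.inverse ((HahnSeries.single (1 : ℤ) (1 : A) : LaurentSeries A) -
              HahnSeries.C (ζ ^ (p ^ e) ^ j)), 1] := by
    rw [Ring.inverse_mul_eq_iff_eq_mul _ _ _ (isUnit_eta _ hζ' h' n)]
    simp only [eta, Matrix.mul_fin_two, mul_one, one_mul, mul_zero, zero_mul, add_zero, zero_add, sub_pow_pow_of_algebra_galoisField, map_sub, sub_mul,
      Finset.sum_sub_distrib]
    rw [neg_add_eq_sub, sub_sub_cancel_left]
  refine ⟨key, ?_⟩
  rw [key]
  constructor
  · intro H
    have H := H 1 0 (-1) (by lia)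
    simp only [Matrix.of_apply, Matrix.cons_val', Matrix.cons_val_zero, Matrix.cons_val_one,
      Matrix.cons_val_fin_one] at H
    rw [HahnSeries.coeff_neg_one_sum_C_mul_prod_inverse hζ' (fun i => (h' - h) ^ (p ^ e) ^ i) hn,
      pow_zero, pow_one, sub_eq_zero] at H
    exact H.symm
  · rintro rfl i j k hk
    have hp : p ≠ 0 := (Fact.out : p.Prime).ne_zero
    fin_cases i <;> fin_cases j <;> simp [HahnSeries.coeff_one, hk.ne, hp]
end
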